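/- Let a, b, c ∈ I be pairwise distinct IRIs and ?x, ?y distinct variables. The pattern ((?x, a, b) OPT (?x, c, ?y)) FILTER ¬bound(?y) is not monotonic: there exist RDF graphs G₁ ⊆ G₂ with ⟦P⟧_{G₁} ⊄ ⟦P⟧_{G₂}. -/

import Mathlib

namespace SPARQL

/-- Kinds of RDF constants: IRIs, blank nodes, literals. -/
inductive Kind : Type
  | iri | blank | lit
deriving DecidableEq

/-- The countably infinite set `U` of constants, partitioned into the three
infinite sets of IRIs `I` (kind `iri`), blank nodes `B` (kind `blank`) and
literals `L` (kind `lit`). -/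
abbrev Const := Kind × ℕ

/-- The countably infinite set `V` of variables (disjoint from `U`). -/
abbrev Var := ℕ

/-- A mapping: a partial function from variables to constants with finite domain. -/
structure Mapping where
  toFun : Var → Option Const
  finite : {x : Var | toFun x ≠ none}.Finite

/-- The domain of a mapping. -/
def Mapping.dom (μ : Mapping) : Set Var := {x | μ.toFun x ≠ none}

/-- Two mappings are compatible if they agree on the intersection of their domains. -/
def Compatible (μ₁ μ₂ : Mapping) : Prop :=
  ∀ x ∈ μ₁.dom ∩ μ₂.dom, μ₁.toFun x = μ₂.toFun x

/-- Union of two mappings (preferring the first one where both are defined). -/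
def Mapping.union (μ₁ μ₂ : Mapping) : Mapping where
  toFun := fun x => match μ₁.toFun x with
    | some u => some u
    | none => μ₂.toFun x
  finite := by
    apply (μ₁.finite.union μ₂.finite).subset
    intro x hx
    simp only [Set.mem_setOf_eq] at hx
    simp only [Set.mem_union, Set.mem_setOf_eq]
    by_cases h1 : μ₁.toFun x = none
    · right; intro h2; apply hx; simp [h1, h2]
    · left; exact h1

/-- A term: either a constant or a variable. -/
inductive Term : Type
  | const : Const → Term
  | var : Var → Term

/-- A triple pattern. -/
abbrev TriplePat := Term × Term × Term

/-- An RDF graph: a finite set of triples of constants. -/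
abbrev Graph := Finset (Const × Const × Const)

/-- Variables of a term. -/
def Term.vars : Term → Set Var
  | .const _ => ∅
  | .var x => {x}

/-- Variables of a triple pattern. -/
def tripleVars (t : TriplePat) : Set Var := t.1.vars ∪ t.2.1.vars ∪ t.2.2.vars

/-- Apply a mapping to a term. -/
def Term.app (μ : Mapping) : Term → Option Const
  | .const c => some c
  | .var x => μ.toFun x

/-- Three truth values: true, false, error. -/
inductive TV : Type
  | t | f | e
deriving DecidableEq

/-- Kleene negation. -/
def TV.neg : TV → TV
  | .t => .f
  | .f => .t
  | .e => .e

/-- Kleene conjunction. -/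
def TV.and : TV → TV → TV
  | .f, _ => .f
  | _, .f => .f
  | .t, .t => .t
  | _, _ => .e

/-- Kleene disjunction. -/
def TV.or : TV → TV → TV
  | .t, _ => .t
  | _, .t => .t
  | .f, .f => .f
  | _, _ => .e

/-- Constraints: Boolean combinations of the atomic constraints
`bound(?x)`, `?x = c`, `?x = ?y`, `isIRI(?x)`, `isBlank(?x)`, `isLiteral(?x)`. -/
inductive Constraint : Type
  | bound : Var → Constraint
  | eqC : Var → Const → Constraint
  | eqV : Var → Var → Constraint
  | isIRI : Var → Constraint
  | isBlank : Var → Constraint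
  | isLiteral : Var → Constraint
  | and : Constraint → Constraint → Constraint
  | or : Constraint → Constraint → Constraint
  | not : Constraint → Constraint

/-- Three-valued evaluation of a constraint on a mapping. -/
def Constraint.eval (μ : Mapping) : Constraint → TV
  | .bound x => match μ.toFun x with
      | some _ => .t
      | none => .f
  | .eqC x c => match μ.toFun x with
      | some u => if u = c then .t else .f
      | none => .e
  | .eqV x y => match μ.toFun x, μ.toFun y with
      | some u, some v => if u = v then .t else .f
      | _, _ => .e
  | .isIRI x => match μ.toFun x with
      | some u => if u.1 = Kind.iri then .t else .f
      | none => .e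
  | .isBlank x => match μ.toFun x with
      | some u => if u.1 = Kind.blank then .t else .f
      | none => .e
  | .isLiteral x => match μ.toFun x with
      | some u => if u.1 = Kind.lit then .t else .f
      | none => .e
  | .and C D => (C.eval μ).and (D.eval μ)
  | .or C D => (C.eval μ).or (D.eval μ)
  | .not C => (C.eval μ).neg

/-- SPARQL graph patterns. -/
inductive Pattern : Type
  | triple : TriplePat → Pattern
  | and : Pattern → Pattern → Pattern
  | union : Pattern → Pattern → Pattern
  | opt : Pattern → Pattern → Pattern
  | filter : Pattern → Constraint → Pattern

/-- `μ(t) ∈ G` for a triple pattern `t`. -/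
def tripleMatch (μ : Mapping) (t : TriplePat) (G : Graph) : Prop :=
  ∃ s p o : Const, t.1.app μ = some s ∧ t.2.1.app μ = some p ∧ t.2.2.app μ = some o ∧
    (s, p, o) ∈ G

/-- Evaluation of a pattern on an RDF graph: a set of mappings. -/
def Pattern.eval (G : Graph) : Pattern → Set Mapping
  | .triple t => {μ | μ.dom = tripleVars t ∧ tripleMatch μ t G}
  | .and P₁ P₂ =>
      {μ | ∃ μ₁ ∈ P₁.eval G, ∃ μ₂ ∈ P₂.eval G, Compatible μ₁ μ₂ ∧ μ = μ₁.union μ₂}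
  | .union P₁ P₂ => P₁.eval G ∪ P₂.eval G
  | .opt P₁ P₂ =>
      {μ | ∃ μ₁ ∈ P₁.eval G, ∃ μ₂ ∈ P₂.eval G, Compatible μ₁ μ₂ ∧ μ = μ₁.union μ₂} ∪
      {μ₁ ∈ P₁.eval G | ∀ μ₂ ∈ P₂.eval G, ¬ Compatible μ₁ μ₂}
  | .filter P C => {μ ∈ P.eval G | C.eval μ = TV.t}

/-- A pattern is monotonic if enlarging the graph enlarges the answer set. -/
def Monotonic (P : Pattern) : Prop :=
  ∀ G₁ G₂ : Graph, G₁ ⊆ G₂ → P.eval G₁ ⊆ P.eval G₂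

/-- Subsumption of mappings: `μ₁ ⊑ μ₂`. -/
def Mapping.Sub (μ₁ μ₂ : Mapping) : Prop :=
  μ₁.dom ⊆ μ₂.dom ∧ ∀ x ∈ μ₁.dom, μ₁.toFun x = μ₂.toFun x

/-- Subsumption of sets of mappings: `Ω₁ ⊑ Ω₂`. -/
def SetSub (Ω₁ Ω₂ : Set Mapping) : Prop :=
  ∀ μ₁ ∈ Ω₁, ∃ μ₂ ∈ Ω₂, μ₁.Sub μ₂

/-- A pattern is weakly monotonic if enlarging the graph subsumes the old answers. -/
def WeaklyMonotonic (P : Pattern) : Prop :=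
  ∀ G₁ G₂ : Graph, G₁ ⊆ G₂ → SetSub (P.eval G₁) (P.eval G₂)

/-- Variables occurring in the triple patterns of a pattern. -/
def Pattern.vars : Pattern → Set Var
  | .triple t => tripleVars t
  | .and P Q => P.vars ∪ Q.vars
  | .union P Q => P.vars ∪ Q.vars
  | .opt P Q => P.vars ∪ Q.vars
  | .filter P _ => P.vars


/-- for pairwise distinct IRIs `a, b, c` and distinct variables
`?x ≠ ?y`, the pattern `((?x, a, b) OPT (?x, c, ?y)) FILTER ¬bound(?y)` is not
monotonic. -/
theorem opt_filter_notbound_not_monotonic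
    (a b c : Const) (ha : a.1 = Kind.iri) (hb : b.1 = Kind.iri)
    (hc : c.1 = Kind.iri) (hab : a ≠ b) (hac : a ≠ c) (hbc : b ≠ c)
    (x y : Var) (hxy : x ≠ y) :
    ∃ G₁ G₂ : Graph, G₁ ⊆ G₂ ∧
      ¬ ((Pattern.filter
          (Pattern.opt
            (Pattern.triple (Term.var x, Term.const a, Term.const b))
            (Pattern.triple (Term.var x, Term.const c, Term.var y)))
          ((Constraint.bound y).not)).eval G₁ ⊆
        (Pattern.filter
          (Pattern.opt
            (Pattern.triple (Term.var x, Term.const a, Term.const b))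
            (Pattern.triple (Term.var x, Term.const c, Term.var y)))
          ((Constraint.bound y).not)).eval G₂) := by
  let μ : Mapping := ⟨fun z => if z = x then some a else none,
    (Set.finite_singleton x).subset (by intro z hz; by_contra h; simp_all)⟩
  let ν : Mapping := ⟨fun z => if z = x ∨ z = y then some a else none,
    (Set.toFinite ({x, y} : Set Var)).subset (by intro z hz; by_contra h; simp_all)⟩
  have hμy : μ.toFun y = none := by simp [μ, hxy.symm]
  have hμx : μ.toFun x = some a := by simp [μ]
  have hμd : μ.dom = tripleVars (Term.var x, Term.const a, Term.const b) := by
    ext z; simp [Mapping.dom, μ, tripleVars, Term.vars]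
  have hνd : ν.dom = tripleVars (Term.var x, Term.const c, Term.var y) := by
    ext z; simp [Mapping.dom, ν, tripleVars, Term.vars]; tauto
  refine ⟨{(a, a, b)}, {(a, a, b), (a, c, a)}, by simp, fun hsub => ?_⟩
  have hmem := @hsub μ ⟨Or.inr ⟨⟨hμd, a, a, b, hμx, rfl, rfl, by simp⟩, ?_⟩, ?_⟩
  · obtain ⟨h | h, -⟩ := hmem
    · obtain ⟨μ₁, -, μ₂, ⟨hd, -⟩, -, he⟩ := h
      have hy : y ∈ μ₂.dom := by rw [hd]; simp [tripleVars, Term.vars]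
      have h1 : (μ₁.union μ₂).toFun y = none := by rw [← he]; exact hμy
      apply hy
      simp only [Mapping.union] at h1
      split at h1
      · cases h1
      · exact h1
    · refine h.2 ν ⟨hνd, a, c, a, by simp [Term.app, ν], rfl, by simp [Term.app, ν], by simp⟩ ?_
      rintro z ⟨hz, -⟩
      rw [hμd] at hz
      have hz' : z = x := by simpa [tripleVars, Term.vars] using hz
      subst hz'
      simp [μ, ν]
  · rintro μ₂ ⟨-, s, p, o, -, h2, -, h4⟩
    have h2' : c = p := by simpa [Term.app] using h2
    simp only [Finset.mem_singleton, Prod.mk.injEq] at h4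
    exact absurd (h4.2.1.symm.trans h2'.symm) hac
  · simp [Constraint.eval, hμy, TV.neg]

end SPARQL
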